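/- Let f : D(ε)* → ℝ be a pluriharmonic function on a punctured polydisc which is continuous and locally bounded. If f is harmonic on each disc slice and locally bounded near the puncture divisor, then f extends to a pluriharmonic function across the divisor. In particular, a function χ on U \ D (U a polydisc, D a union of coordinate hyperplanes) that is pluriharmonic off D and has log-log growth along D extends to a pluriharmonic function on U. -/

import Mathlib

/-- The Laplacian of a function `f : ℂ → ℝ`. -/
noncomputable def lapC (f : ℂ → ℝ) (z : ℂ) : ℝ :=
  iteratedFDeriv ℝ 2 f z ![1, 1] + iteratedFDeriv ℝ 2 f z ![Complex.I, Complex.I]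

/-- Harmonicity of `f : ℂ → ℝ` on a set. -/
def HarmOn (f : ℂ → ℝ) (s : Set ℂ) : Prop :=
  ContDiffOn ℝ 2 f s ∧ ∀ z ∈ s, lapC f z = 0

/-- A function on an open set of `ℂ^q` is pluriharmonic if its restriction to every
complex line is harmonic (where defined). -/
def PluriharmOn (q : ℕ) (f : (Fin q → ℂ) → ℝ) (s : Set (Fin q → ℂ)) : Prop :=
  ∀ a b : Fin q → ℂ, HarmOn (fun t : ℂ => f (a + t • b)) {t : ℂ | a + t • b ∈ s}

/-- The unit polydisc in `ℂ^q`. -/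
def polyDisc (q : ℕ) : Set (Fin q → ℂ) := {z | ∀ i, ‖z i‖ < 1}

/-- The normal crossing divisor `∪_{i<l} {z_i = 0}`. -/
def ncDivisor (q l : ℕ) : Set (Fin q → ℂ) := {z | ∃ i : Fin q, (i : ℕ) < l ∧ z i = 0}

/-- `max_{i<l} |z_i|`. -/
noncomputable def maxCoordNorm (q l : ℕ) (z : Fin q → ℂ) : ℝ :=
  ⨆ i : Fin q, if (i : ℕ) < l then ‖z i‖ else 0

open Filter Topology Metric Set Asymptotics InnerProductSpace MeasureTheory

theorem HarmonicOnNhd.abs_sub_le {u : ℂ → ℝ} {z w : ℂ} {R M : ℝ} (hM : 0 < M)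
    (hu : HarmonicOnNhd u (ball z R)) (hb : ∀ x ∈ ball z R, |u x| ≤ M) (hw : ‖w‖ < R) :
    |u (z + w) - u z| ≤ 4 * M * ‖w‖ / (R - ‖w‖) := by
  have hR : 0 < R := (norm_nonneg w).trans_lt hw
  obtain ⟨F, hF, hFu⟩ := hu.exists_analyticOnNhd_ball_re_eq
  have hmem : ∀ x ∈ ball (0 : ℂ) R, z + x ∈ ball z R := fun x hx => by simpa using hx
  have hre : ∀ x ∈ ball z R, (F x).re = u x := hFu
  have key := Complex.borelCaratheodory_zero (f := fun x => F (z + x) - F z) (M := 2 * M)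
    (R := R) (z := w) (by positivity) ?_ ?_ hR (by simpa using hw) (by simp)
  · have h1 := Complex.abs_re_le_norm (F (z + w) - F z)
    rw [Complex.sub_re, hre _ (hmem w (by simpa using hw)), hre _ (mem_ball_self hR)] at h1
    refine h1.trans (key.trans_eq ?_)
    ring
  · refine DifferentiableOn.sub_const ?_ _
    exact hF.differentiableOn.comp (by fun_prop) hmem
  · intro x hx
    have h1 := abs_le.1 (hb _ (hmem x hx))
    have h2 := abs_le.1 (hb _ (mem_ball_self hR))
    simp only [mem_ofPred_eq, Complex.sub_re, hre _ (hmem x hx), hre _ (mem_ball_self hR)]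
    linarith

theorem HarmonicOnNhd.norm_fderiv_le {u : ℂ → ℝ} {z : ℂ} {R M : ℝ} (hM : 0 < M) (hR : 0 < R)
    (hu : HarmonicOnNhd u (ball z R)) (hb : ∀ x ∈ ball z R, |u x| ≤ M) :
    ‖fderiv ℝ u z‖ ≤ 8 * M / R := by
  have hd : HasFDerivAt u (fderiv ℝ u z) z :=
    ((hu z (mem_ball_self hR)).1.differentiableAt (by norm_num)).hasFDerivAt
  refine hd.le_of_lip' (by positivity) ?_
  filter_upwards [ball_mem_nhds z (half_pos hR)] with x hx
  have hx' : ‖x - z‖ < R / 2 := by simpa [dist_eq_norm] using hx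
  have h := HarmonicOnNhd.abs_sub_le (w := x - z) hM hu hb (by linarith)
  rw [add_sub_cancel] at h
  refine h.trans ?_
  rw [div_le_iff₀ (by linarith)]
  have : 4 * M * ‖x - z‖ = 8 * M / R * ‖x - z‖ * (R / 2) := by
    field_simp
    ring
  rw [this]
  gcongr
  linarith

theorem HarmonicAt.hasFDerivAt_re_mul {u : ℂ → ℝ} {z : ℂ} (hu : HarmonicAt u z) :
    HasFDerivAt u (Complex.reCLM ∘L ((ContinuousLinearMap.mul ℝ ℂ)
      ((fderiv ℝ u z 1 : ℂ) - Complex.I * (fderiv ℝ u z Complex.I : ℂ)))) z := by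
  have hd := (hu.1.differentiableAt (by norm_num)).hasFDerivAt
  refine hd.congr_fderiv ?_
  ext v
  have hv : v = v.re • (1 : ℂ) + v.im • Complex.I := by apply Complex.ext <;> simp
  conv_lhs => rw [hv, map_add, map_smul, map_smul]
  simp
  ring

/-- A harmonic function on a punctured disc that is `o(log ‖z - c‖)` at the puncture extends
harmonically. -/
theorem HarmonicOnNhd.exists_extension {u : ℂ → ℝ} {c : ℂ} {R : ℝ} (hR : 0 < R)
    (hu : HarmonicOnNhd u (ball c R \ {c}))
    (ho : u =o[𝓝[≠] c] fun z => Real.log ‖z - c‖) :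
    ∃ E : ℂ → ℝ, HarmonicOnNhd E (ball c R) ∧ ∀ z ∈ ball c R, z ≠ c → E z = u z := by
  set g : ℂ → ℂ := fun z => (fderiv ℝ u z 1 : ℂ) - Complex.I * (fderiv ℝ u z Complex.I : ℂ) with hg
  have hgd : DifferentiableOn ℂ g (ball c R \ {c}) := fun z hz =>
    (HarmonicAt.differentiableAt_complex_partial (hu z hz)).differentiableWithinAt
  have hnorm : Tendsto (fun z : ℂ => ‖z - c‖) (𝓝[≠] c) (𝓝[>] 0) := tendsto_norm_sub_self_nhdsNE c
  have hlog : (fun z : ℂ => Real.log ‖z - c‖) =o[𝓝[≠] c] fun z => ‖z - c‖⁻¹ := by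
    have := (isLittleO_log_rpow_nhdsGT_zero (r := -1) (by norm_num)).comp_tendsto hnorm
    refine this.congr_right fun z => ?_
    simp [Real.rpow_neg_one]
  set k : ℂ → ℂ := fun z => (z - c) * g z with hk
  have hko : (fun z => k z - k c) =o[𝓝[≠] c] fun z => (z - c)⁻¹ := by
    rw [isLittleO_iff]
    intro ε hε
    have h1 := (ho.trans hlog).def (show 0 < ε / 64 by positivity)
    rw [eventually_nhdsWithin_iff, Metric.eventually_nhds_iff] at h1
    obtain ⟨δ, hδ, h1⟩ := h1
    rw [eventually_nhdsWithin_iff, Metric.eventually_nhds_iff]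
    refine ⟨min (δ / 2) (R / 2), by positivity, fun z hz hzc => ?_⟩
    have hzδ : ‖z - c‖ < δ / 2 := by
      rw [← dist_eq_norm]; exact hz.trans_le (min_le_left _ _)
    have hzR : ‖z - c‖ < R / 2 := by
      rw [← dist_eq_norm]; exact hz.trans_le (min_le_right _ _)
    have hpos : 0 < ‖z - c‖ := norm_pos_iff.2 (sub_ne_zero.2 hzc)
    have hball : ∀ x ∈ ball z (‖z - c‖ / 2), ‖z - c‖ / 2 < ‖x - c‖ ∧
        ‖x - c‖ < 2 * ‖z - c‖ := by
      intro x hx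
      have hx' : ‖x - z‖ < ‖z - c‖ / 2 := by simpa [dist_eq_norm] using hx
      have e1 := norm_sub_norm_le (z - c) (z - x)
      have e2 : z - c - (z - x) = x - c := by ring
      have e3 : ‖z - x‖ = ‖x - z‖ := norm_sub_rev _ _
      have e4 := norm_add_le (x - z) (z - c)
      rw [sub_add_sub_cancel] at e4
      rw [e2, e3] at e1
      constructor <;> linarith
    have hgrad := HarmonicOnNhd.norm_fderiv_le (u := u) (z := z) (R := ‖z - c‖ / 2)
      (M := ε / 64 * (‖z - c‖ / 2)⁻¹) (by positivity) (by positivity) (hu.mono ?_) ?_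
    · have n1 : ‖fderiv ℝ u z 1‖ ≤ ‖fderiv ℝ u z‖ := by
        simpa using (fderiv ℝ u z).le_opNorm 1
      have n2 : ‖fderiv ℝ u z Complex.I‖ ≤ ‖fderiv ℝ u z‖ := by
        simpa using (fderiv ℝ u z).le_opNorm Complex.I
      have hgz : ‖g z‖ ≤ 2 * ‖fderiv ℝ u z‖ := by
        refine (norm_sub_le _ _).trans ?_
        simp only [norm_mul, Complex.norm_I, one_mul, Complex.norm_real]
        linarith
      have hkc : k c = 0 := by simp [hk]
      rw [hkc, sub_zero, hk, norm_inv]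
      simp only [norm_mul]
      calc ‖z - c‖ * ‖g z‖ ≤ ‖z - c‖ * (2 * (8 * (ε / 64 * (‖z - c‖ / 2)⁻¹) / (‖z - c‖ / 2))) := by
            gcongr
            exact hgz.trans (by gcongr)
        _ = ε * ‖z - c‖⁻¹ := by field_simp; norm_num
    · intro x hx
      obtain ⟨a1, a2⟩ := hball x hx
      refine ⟨by rw [mem_ball, dist_eq_norm]; linarith, fun h => ?_⟩
      rw [mem_singleton_iff.1 h] at a1
      simp at a1
      linarith
    · intro x hx
      obtain ⟨a1, a2⟩ := hball x hx
      have := h1 (y := x) (by rw [dist_eq_norm]; linarith) (fun h => by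
        rw [mem_singleton_iff.1 h] at a1
        simp at a1
        linarith)
      rw [Real.norm_eq_abs, norm_inv, norm_norm] at this
      refine this.trans ?_
      gcongr
  set K := Function.update k c (limUnder (𝓝[≠] c) k) with hK
  have hKd : DifferentiableOn ℂ K (ball c R) :=
    Complex.differentiableOn_update_limUnder_of_isLittleO (ball_mem_nhds c hR)
      ((by fun_prop : DifferentiableOn ℂ (fun z => z - c) _).mul hgd) hko
  obtain ⟨H, hH⟩ := ((Complex.differentiableOn_dslope (ball_mem_nhds c hR)).2 hKd).isExactOn_ball
  set a := K c
  have hgeq : ∀ z ≠ c, g z = a / (z - c) + dslope K c z := by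
    intro z hz
    have hz' : z - c ≠ 0 := sub_ne_zero.2 hz
    rw [dslope_of_ne _ hz, slope_def_field, show K z = (z - c) * g z from
      Function.update_of_ne hz _ _]
    field_simp
    ring
  -- pull back to a half plane by the exponential
  set S : Set ℂ := {w | w.re < Real.log R} with hS
  have hexp : ∀ w ∈ S, c + Complex.exp w ∈ ball c R \ {c} := by
    intro w hw
    refine ⟨?_, by simp⟩
    rw [mem_ball, dist_eq_norm, add_sub_cancel_left, Complex.norm_exp]
    exact (Real.lt_log_iff_exp_lt hR).1 hw
  set W : ℂ → ℝ := fun w =>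
    u (c + Complex.exp w) - (H (c + Complex.exp w)).re - (a * w).re with hW
  have hWd : ∀ w ∈ S, HasFDerivAt W (0 : ℂ →L[ℝ] ℝ) w := by
    intro w hw
    have he : HasDerivAt (fun w => c + Complex.exp w) (Complex.exp w) w :=
      (Complex.hasDerivAt_exp w).const_add c
    have heR : HasFDerivAt (fun w => c + Complex.exp w)
      ((ContinuousLinearMap.mul ℝ ℂ) (Complex.exp w)) w := by
      convert he.complexToReal_fderiv using 1
      ext
      simp
    have d1 := (HarmonicAt.hasFDerivAt_re_mul (hu _ (hexp w hw))).comp w heR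
    have hh := (hH _ (hexp w hw).1).comp w he
    have hh' : HasDerivAt (fun w => H (c + Complex.exp w) + a * w)
        (dslope K c (c + Complex.exp w) * Complex.exp w + a) w := by
      refine hh.add ?_
      simpa using (hasDerivAt_id w).const_mul a
    have d2 := (Complex.reCLM.hasFDerivAt).comp w hh'.complexToReal_fderiv
    have d3 := d1.sub d2
    have hz : (Complex.exp w) ≠ 0 := Complex.exp_ne_zero w
    have hgg := hgeq (c + Complex.exp w) (by simp)
    rw [add_sub_cancel_left] at hgg
    have hmul : dslope K c (c + Complex.exp w) * Complex.exp w + a =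
        g (c + Complex.exp w) * Complex.exp w := by
      rw [hgg]
      field_simp
      ring
    have hWeq : W = (u ∘ fun w => c + Complex.exp w) -
        Complex.reCLM ∘ fun w => H (c + Complex.exp w) + a * w := by
      ext x
      simp [hW]
      ring
    rw [hWeq]
    refine d3.congr_fderiv ?_
    rw [hmul]
    ext
    simp [hg]
    ring
  have hSconv : Convex ℝ S := convex_halfSpace_re_lt _
  have hSopen : IsOpen S := isOpen_lt Complex.continuous_re continuous_const
  have hconst : ∀ x ∈ S, ∀ y ∈ S, W x = W y := fun x hx y hy =>
    hSopen.is_const_of_fderiv_eq_zero (𝕜 := ℝ) hSconv.isPreconnected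
      (fun w hw => (hWd w hw).differentiableAt.differentiableWithinAt)
      (fun w hw => (hWd w hw).fderiv) hx hy
  set s₀ : ℂ := ((Real.log R - 1 : ℝ) : ℂ) with hs₀
  have hs₀S : s₀ ∈ S := by simp [hS, hs₀]
  have haim : a.im = 0 := by
    have h2 : s₀ + 2 * Real.pi * Complex.I ∈ S := by simp [hS, hs₀]
    have := hconst _ hs₀S _ h2
    simp only [hW, Complex.exp_add, Complex.exp_two_pi_mul_I, mul_one] at this
    simp [mul_add] at this
    simpa [Real.pi_ne_zero] using this
  have hare : a.re = 0 := by
    have hW0 : ∀ s : ℝ, s < Real.log R → u (c + Complex.exp s) =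
        (H (c + Complex.exp s)).re + a.re * s + W s₀ := by
      intro s hs
      have := hconst (s : ℂ) (by simpa [hS] using hs) _ hs₀S
      rw [← this]
      simp [hW]
    have hts : Tendsto (fun s : ℝ => c + Complex.exp s) atBot (𝓝[≠] c) := by
      rw [tendsto_nhdsWithin_iff]
      refine ⟨?_, by simp⟩
      have : Tendsto (fun s : ℝ => Complex.exp s) atBot (𝓝 0) := by
        refine Complex.tendsto_exp_comap_re_atBot.comp ?_
        rw [tendsto_comap_iff]
        simpa [Function.comp_def] using! tendsto_id
      simpa using this.const_add c
    have t1 : Tendsto (fun s : ℝ => u (c + Complex.exp s) / s) atBot (𝓝 0) := by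
      have := (ho.comp_tendsto hts).tendsto_div_nhds_zero
      refine this.congr fun s => ?_
      simp [Complex.norm_exp]
    have t2 : Tendsto (fun s : ℝ => ((H (c + Complex.exp s)).re + W s₀) / s) atBot (𝓝 0) := by
      refine Tendsto.div_atBot (a := (H c).re + W s₀) ?_ tendsto_id
      have hc : ContinuousAt H c := (hH c (mem_ball_self hR)).continuousAt
      have := hc.tendsto.comp (hts.mono_right nhdsWithin_le_nhds)
      exact ((Complex.continuous_re.tendsto _).comp this).add_const _
    have t3 := t1.sub t2
    have : Tendsto (fun _ : ℝ => a.re) atBot (𝓝 (0 - 0)) := by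
      refine t3.congr' ?_
      filter_upwards [eventually_lt_atBot (Real.log R), eventually_lt_atBot 0] with s h1 h2
      have := h2.ne
      rw [hW0 s h1]
      field_simp
      ring
    simpa using tendsto_nhds_unique tendsto_const_nhds this
  have ha : a = 0 := Complex.ext hare haim
  refine ⟨fun z => (H z + (W s₀ : ℂ)).re, fun z hz => ?_, fun z hz hzc => ?_⟩
  · have hHd : DifferentiableOn ℂ H (ball c R) := fun z hz =>
      (hH z hz).differentiableAt.differentiableWithinAt
    exact AnalyticAt.harmonicAt_re
      ((hHd.analyticAt (isOpen_ball.mem_nhds hz)).add analyticAt_const)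
  · have hz' : z - c ≠ 0 := sub_ne_zero.2 hzc
    have hlz : Complex.log (z - c) ∈ S := by
      rw [hS, mem_ofPred_eq, Complex.log_re]
      exact Real.log_lt_log (norm_pos_iff.2 hz') (by simpa [dist_eq_norm] using hz)
    have := hconst _ hlz _ hs₀S
    simp only [Complex.add_re, Complex.ofReal_re, ← this]
    simp [hW, Complex.exp_log hz', ha]

theorem circleAverage_swap {G : ℂ → ℂ → ℝ} {r ρ : ℝ}
    (hG : Continuous fun p : ℝ × ℝ => G (circleMap 0 r p.1) (circleMap 0 ρ p.2)) :
    Real.circleAverage (fun s => Real.circleAverage (G s) 0 ρ) 0 r =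
      Real.circleAverage (fun t => Real.circleAverage (fun s => G s t) 0 r) 0 ρ := by
  simp only [Real.circleAverage, intervalIntegral.integral_smul]
  congr 2
  have hπ : (0 : ℝ) ≤ 2 * Real.pi := by positivity
  simp only [intervalIntegral.integral_of_le hπ]
  refine integral_integral_swap ?_
  rw [Measure.prod_restrict]
  exact (hG.continuousOn.integrableOn_compact (isCompact_Icc.prod isCompact_Icc)).mono_set
    (prod_mono Ioc_subset_Icc_self Ioc_subset_Icc_self)

/-- A circle average of a continuous family of harmonic functions is the real part of an analytic
function. -/
theorem exists_analyticAt_re_eq_circleAverage {G : ℂ → ℂ → ℝ} {r ρ : ℝ} (hr : 0 < r) (hρ : 0 < ρ)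
    (hc : ContinuousOn (Function.uncurry G) (sphere 0 r ×ˢ closedBall 0 ρ))
    (hh : ∀ s ∈ sphere (0 : ℂ) r, HarmonicOnNhd (G s) (closedBall 0 ρ)) :
    ∃ F : ℂ → ℂ, AnalyticAt ℂ F 0 ∧
      ∀ w ∈ ball (0 : ℂ) ρ, Real.circleAverage (fun s => G s w) 0 r = (F w).re := by
  set h : ℂ → ℝ := fun w => Real.circleAverage (fun s => G s w) 0 r with hdef
  have hmr : ∀ θ : ℝ, circleMap 0 r θ ∈ sphere (0 : ℂ) r := fun θ => circleMap_mem_sphere _ hr.le _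
  have hmρ : ∀ θ : ℝ, circleMap 0 ρ θ ∈ sphere (0 : ℂ) ρ := fun θ => circleMap_mem_sphere _ hρ.le _
  have hG : Continuous fun p : ℝ × ℝ => G (circleMap 0 r p.1) (circleMap 0 ρ p.2) := by
    refine hc.comp_continuous
      (f := fun p : ℝ × ℝ => (circleMap 0 r p.1, circleMap 0 ρ p.2)) (by fun_prop) fun p =>
      ⟨hmr _, sphere_subset_closedBall (hmρ _)⟩
  have hint : CircleIntegrable h 0 ρ := by
    refine Continuous.intervalIntegrable ?_ _ _
    simp only [hdef, Real.circleAverage]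
    have := intervalIntegral.continuous_parametric_intervalIntegral_of_continuous'
      (μ := volume) (f := fun x θ => G (circleMap 0 r θ) (circleMap 0 ρ x))
      (hG.comp (continuous_swap (X := ℝ) (Y := ℝ))) 0 (2 * Real.pi)
    simp only [smul_eq_mul]
    exact continuous_const.mul this
  have hint' : CircleIntegrable (fun ζ => (h ζ : ℂ)) 0 ρ :=
    ⟨hint.1.ofReal, hint.2.ofReal⟩
  refine ⟨_, analyticOnNhd_circleAverage_herglotzRieszKernel_smul hint' 0 (mem_ball_self hρ),
    fun w hw => ?_⟩
  rw [re_circleAverage_herglotzRieszKernel_smul hint hw]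
  have h1 : Real.circleAverage (fun s => G s w) 0 r = Real.circleAverage (fun s =>
      Real.circleAverage (fun t => (herglotzRieszKernel 0 w t).re * G s t) 0 ρ) 0 r := by
    refine Real.circleAverage_congr_sphere fun s hs => ?_
    rw [abs_of_pos hr] at hs
    exact ((hh s hs).circleAverage_re_herglotzRieszKernel_smul hw).symm
  rw [h1, circleAverage_swap]
  · refine Real.circleAverage_congr_sphere fun t ht => ?_
    have := Real.circleAverage_fun_smul (a := (herglotzRieszKernel 0 w t).re)
      (f := fun s => G s t) (c := 0) (R := r)
    simpa [hdef] using this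
  · refine Continuous.mul ?_ hG
    refine Complex.continuous_re.comp ?_
    have hk := continuousOn_herglotzRieszKernel_sphere hw
    rw [abs_of_pos hρ] at hk
    exact hk.comp_continuous (by fun_prop) fun p => hmρ p.2

theorem eventually_nhdsNE_ne {X : Type*} [TopologicalSpace X] [T1Space X] (x y : X) :
    ∀ᶠ z in 𝓝[≠] x, z ≠ y := by
  rcases eq_or_ne x y with rfl | h
  · exact eventually_mem_nhdsWithin
  · exact (eventually_ne_nhds h).filter_mono nhdsWithin_le_nhds

theorem HarmonicOnNhd.limUnder_extension
    {u : ℂ → ℝ} {O : Set ℂ}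
    (hu : ∀ t ∈ O, ∀ᶠ s in 𝓝[≠] t, HarmonicAt u s)
    (ho : ∀ t ∈ O, u =o[𝓝[≠] t] fun s => Real.log ‖s - t‖) :
    HarmonicOnNhd (fun t => limUnder (𝓝[≠] t) u) O := by
  intro t ht
  have h := hu t ht
  rw [eventually_nhdsWithin_iff, Metric.eventually_nhds_iff] at h
  obtain ⟨R, hR, h⟩ := h
  obtain ⟨E, hE, hEu⟩ := HarmonicOnNhd.exists_extension (c := t) hR (fun s hs => h hs.1 hs.2) (ho t ht)
  refine (harmonicAt_congr_nhds ?_).1 (hE t (mem_ball_self hR))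
  filter_upwards [ball_mem_nhds t hR] with s hs
  have hcont : Tendsto E (𝓝[≠] s) (𝓝 (E s)) :=
    (hE s hs).1.continuousAt.tendsto.mono_left nhdsWithin_le_nhds
  refine (Tendsto.limUnder_eq (hcont.congr' ?_)).symm
  filter_upwards [eventually_nhdsNE_ne s t, mem_nhdsWithin_of_mem_nhds (isOpen_ball.mem_nhds hs)] with x h1 h2
  exact hEu x h2 h1

theorem HarmOn.harmonicOnNhd {f : ℂ → ℝ} {s : Set ℂ} (hs : IsOpen s) (h : HarmOn f s) :
    HarmonicOnNhd f s := by
  intro z hz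
  refine ⟨h.1.contDiffAt (hs.mem_nhds hz), ?_⟩
  filter_upwards [hs.mem_nhds hz] with w hw
  rw [laplacian_eq_iteratedFDeriv_complexPlane]
  exact h.2 w hw

theorem HarmonicOnNhd.harmOn {f : ℂ → ℝ} {s : Set ℂ} (h : HarmonicOnNhd f s) : HarmOn f s := by
  refine ⟨h.contDiffOn, fun z hz => ?_⟩
  have := (h z hz).2.self_of_nhds
  rwa [laplacian_eq_iteratedFDeriv_complexPlane] at this

theorem isOpen_polyDisc (q : ℕ) : IsOpen (polyDisc q) := by
  simp only [polyDisc, ofPred_forall]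
  exact isOpen_iInter_of_finite fun i => isOpen_lt (by fun_prop) continuous_const

theorem isClosed_ncDivisor (q l : ℕ) : IsClosed (ncDivisor q l) := by
  simp only [ncDivisor, ofPred_exists]
  refine isClosed_iUnion_of_finite fun i => ?_
  by_cases h : (i : ℕ) < l
  · simpa [h] using isClosed_eq (by fun_prop) continuous_const
  · simp [h]

theorem continuous_maxCoordNorm {q : ℕ} (l : ℕ) (hq : 0 < q) :
    Continuous (maxCoordNorm q l) := by
  have : Nonempty (Fin q) := ⟨⟨0, hq⟩⟩
  unfold maxCoordNorm
  simp only [← Finset.sup'_univ_eq_ciSup]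
  refine Continuous.finset_sup'_apply _ fun i _ => ?_
  split_ifs <;> fun_prop

theorem norm_le_maxCoordNorm {q l : ℕ} (z : Fin q → ℂ) {i : Fin q} (hi : (i : ℕ) < l) :
    ‖z i‖ ≤ maxCoordNorm q l z := by
  have := le_ciSup (f := fun i : Fin q => if (i : ℕ) < l then ‖z i‖ else 0)
    (finite_range _).bddAbove i
  rw [if_pos hi] at this
  exact this

theorem maxCoordNorm_lt_one {q : ℕ} (l : ℕ) (hq : 0 < q) {z : Fin q → ℂ} (hz : z ∈ polyDisc q) :
    maxCoordNorm q l z < 1 := by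
  have : Nonempty (Fin q) := ⟨⟨0, hq⟩⟩
  obtain ⟨i, hi⟩ := exists_eq_ciSup_of_finite (f := fun i : Fin q => if (i : ℕ) < l then ‖z i‖ else 0)
  rw [maxCoordNorm, ← hi]
  split_ifs
  · exact hz i
  · exact one_pos

theorem maxCoordNorm_eq_of_forall {q l : ℕ} (hl : 1 ≤ l) (hlq : l ≤ q) {z : Fin q → ℂ} {c : ℝ}
    (hc : ∀ i : Fin q, (i : ℕ) < l → ‖z i‖ = c) : maxCoordNorm q l z = c := by
  have hq : 0 < q := hl.trans hlq
  have : Nonempty (Fin q) := ⟨⟨0, hq⟩⟩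
  have h0 := hc ⟨0, hq⟩ hl
  refine le_antisymm (ciSup_le fun i => ?_) (h0 ▸ norm_le_maxCoordNorm z hl)
  split_ifs with hi
  · exact (hc i hi).le
  · exact h0 ▸ norm_nonneg _

/-- A locally bounded pluriharmonic function is continuous. -/
theorem PluriharmOn.continuousOn {q : ℕ} {f : (Fin q → ℂ) → ℝ} {s : Set (Fin q → ℂ)}
    (h : PluriharmOn q f s) (hs : IsOpen s) (hb : ∀ z ∈ s, ∃ M, ∀ᶠ w in 𝓝 z, |f w| ≤ M) :
    ContinuousOn f s := by
  intro z hz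
  obtain ⟨M, hM⟩ := hb z hz
  obtain ⟨δ, hδ, hδs⟩ := Metric.eventually_nhds_iff.1 (hM.and (hs.mem_nhds hz))
  have hbound : ∀ᶠ w in 𝓝 z, |f w - f z| ≤ 4 * max M 1 * ‖w - z‖ / (δ - ‖w - z‖) := by
    filter_upwards [ball_mem_nhds z hδ] with w hw
    have hw' : ‖w - z‖ < δ := by simpa [dist_eq_norm] using hw
    rcases eq_or_ne w z with rfl | hne
    · simp
    have hpos : 0 < ‖w - z‖ := norm_pos_iff.2 (sub_ne_zero.2 hne)
    set b : Fin q → ℂ := (‖w - z‖ : ℂ)⁻¹ • (w - z) with hbdef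
    have hbn : ‖b‖ = 1 := by
      rw [hbdef, norm_smul, norm_inv, Complex.norm_real, norm_norm, inv_mul_cancel₀ hpos.ne']
    have hmem : ∀ t ∈ ball (0 : ℂ) δ, |f (z + t • b)| ≤ M ∧ z + t • b ∈ s := fun t ht =>
      hδs (by simpa [dist_eq_norm, norm_smul, hbn] using ht)
    have hopen : IsOpen {t : ℂ | z + t • b ∈ s} := hs.preimage (by fun_prop)
    have key := HarmonicOnNhd.abs_sub_le (u := fun t => f (z + t • b)) (z := 0) (R := δ)
      (w := (‖w - z‖ : ℂ)) (M := max M 1) (by positivity)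
      (((h z b).harmonicOnNhd hopen).mono fun t ht => (hmem t ht).2)
      (fun t ht => (hmem t ht).1.trans (le_max_left _ _)) (by simpa using hw')
    have hne' : (‖w - z‖ : ℂ) ≠ 0 := by exact_mod_cast hpos.ne'
    simpa [hbdef, smul_smul, hne'] using key
  refine ContinuousAt.continuousWithinAt ?_
  rw [ContinuousAt, tendsto_iff_norm_sub_tendsto_zero]
  refine squeeze_zero' (.of_forall fun _ => norm_nonneg _) hbound ?_
  have : ContinuousAt (fun w => 4 * max M 1 * ‖w - z‖ / (δ - ‖w - z‖)) z :=
    ContinuousAt.div (by fun_prop) (by fun_prop) (by simpa using hδ.ne')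
  simpa [ContinuousAt] using this

theorem tendsto_abs_log_norm_sub (c : ℂ) :
    Tendsto (fun s : ℂ => |Real.log ‖s - c‖|) (𝓝[≠] c) atTop :=
  tendsto_abs_atBot_atTop.comp
    (Real.tendsto_log_nhdsGT_zero.comp (tendsto_norm_sub_self_nhdsNE c))

theorem isLittleO_const_log_norm_sub (c : ℂ) (M : ℝ) :
    (fun _ : ℂ => M) =o[𝓝[≠] c] fun s => Real.log ‖s - c‖ :=
  isLittleO_const_left.2 (Or.inr (tendsto_abs_log_norm_sub c))

theorem isLittleO_loglog_norm_sub (c : ℂ) (C : ℝ) (p : ℕ) :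
    (fun s : ℂ => C * Real.log |Real.log ‖s - c‖| ^ p + C) =o[𝓝[≠] c]
      fun s => Real.log ‖s - c‖ := by
  refine IsLittleO.add (IsLittleO.const_mul_left ?_ _) (isLittleO_const_log_norm_sub c C)
  have := (Real.isLittleO_pow_log_id_atTop (n := p)).comp_tendsto (tendsto_abs_log_norm_sub c)
  exact isLittleO_abs_right.1 this

section Growth

variable {q l : ℕ} {χ : (Fin q → ℂ) → ℝ} {C : ℝ} {p : ℕ}

theorem exists_eventually_abs_le_of_growth (hq : 0 < q)
    (hg : ∀ z ∈ polyDisc q \ ncDivisor q l,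
      |χ z| ≤ C * (Real.log |Real.log (maxCoordNorm q l z)|) ^ p + C)
    {w : Fin q → ℂ} (hw : w ∈ polyDisc q) (hw0 : 0 < maxCoordNorm q l w) :
    ∃ M, ∀ᶠ z in 𝓝 w, z ∈ polyDisc q \ ncDivisor q l → |χ z| ≤ M := by
  have hlog : Real.log (maxCoordNorm q l w) ≠ 0 :=
    (Real.log_neg hw0 (maxCoordNorm_lt_one l hq hw)).ne
  have hm : ContinuousAt (maxCoordNorm q l) w := (continuous_maxCoordNorm l hq).continuousAt
  have hc : ContinuousAt
      (fun z => C * (Real.log |Real.log (maxCoordNorm q l z)|) ^ p + C) w :=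
    ((((hm.log hw0.ne').abs.log (abs_ne_zero.2 hlog)).pow p).const_mul C).add_const C
  refine ⟨C * (Real.log |Real.log (maxCoordNorm q l w)|) ^ p + C + 1, ?_⟩
  filter_upwards [hc.eventually_lt continuousAt_const (lt_add_one _)] with z hz hzs
  exact (hg z hzs).trans hz.le

theorem eventually_add_smul_mem_sdiff {z : Fin q → ℂ} {t : ℂ} (ht : z + t • 1 ∈ polyDisc q) :
    ∀ᶠ s in 𝓝[≠] t, z + s • 1 ∈ polyDisc q \ ncDivisor q l := by
  have h1 : ∀ᶠ s in 𝓝[≠] t, z + s • 1 ∈ polyDisc q := by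
    refine Eventually.filter_mono nhdsWithin_le_nhds ?_
    exact ((isOpen_polyDisc q).preimage
      (by fun_prop : Continuous fun s : ℂ => z + s • (1 : Fin q → ℂ))).mem_nhds ht
  have h2 : ∀ᶠ s in 𝓝[≠] t, ∀ i : Fin q, s ≠ -z i :=
    eventually_all.2 fun i => eventually_nhdsNE_ne t _
  filter_upwards [h1, h2] with s hs1 hs2
  refine ⟨hs1, fun ⟨i, _, hi⟩ => hs2 i ?_⟩
  simp only [Pi.add_apply, Pi.smul_apply, Pi.one_apply, smul_eq_mul, mul_one] at hi
  linear_combination hi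

theorem isLittleO_slice_log (hl : 1 ≤ l) (hlq : l ≤ q)
    (hg : ∀ z ∈ polyDisc q \ ncDivisor q l,
      |χ z| ≤ C * (Real.log |Real.log (maxCoordNorm q l z)|) ^ p + C)
    {z : Fin q → ℂ} {t : ℂ} (ht : z + t • 1 ∈ polyDisc q) :
    (fun s : ℂ => χ (z + s • 1)) =o[𝓝[≠] t] fun s => Real.log ‖s - t‖ := by
  have hev := eventually_add_smul_mem_sdiff (l := l) ht
  by_cases h : ∀ i : Fin q, (i : ℕ) < l → z i + t = 0
  · refine IsBigO.trans_isLittleO (IsBigO.of_bound 1 ?_) (isLittleO_loglog_norm_sub t C p)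
    filter_upwards [hev] with s hs
    have hm : maxCoordNorm q l (z + s • 1) = ‖s - t‖ := by
      refine maxCoordNorm_eq_of_forall hl hlq fun i hi => ?_
      simp only [Pi.add_apply, Pi.smul_apply, Pi.one_apply, smul_eq_mul, mul_one]
      congr 1
      linear_combination h i hi
    have := hg _ hs
    rw [hm] at this
    rw [one_mul]
    exact this.trans (le_abs_self _)
  · push Not at h
    obtain ⟨i, hi, hne⟩ := h
    have hpos : 0 < maxCoordNorm q l (z + t • 1) :=
      (norm_pos_iff.2 (by simpa using hne)).trans_le (norm_le_maxCoordNorm _ hi)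
    obtain ⟨M, hM⟩ := exists_eventually_abs_le_of_growth (hl.trans hlq) hg ht hpos
    refine IsBigO.trans_isLittleO (IsBigO.of_bound 1 ?_) (isLittleO_const_log_norm_sub t M)
    have hM' := ((by fun_prop : Continuous fun s : ℂ => z + s • (1 : Fin q → ℂ)).tendsto
      t).eventually hM
    filter_upwards [hev, hM'.filter_mono nhdsWithin_le_nhds] with s hs h1
    rw [one_mul]
    exact (h1 hs).trans (le_abs_self _)

end Growth

/-- A function `χ` on `U \ D` (with `U` the unit polydisc in `ℂ^q` and
`D = ∪_{i<l}{z_i = 0}` a union of coordinate hyperplanes) which is pluriharmonic off `D`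
and has log-log growth along `D` extends to a pluriharmonic function on `U`. -/
theorem stmt7 (q l : ℕ) (hl : 1 ≤ l) (hlq : l ≤ q)
    (χ : (Fin q → ℂ) → ℝ)
    (hharm : PluriharmOn q χ (polyDisc q \ ncDivisor q l))
    (hgrowth : ∃ C > 0, ∃ p : ℕ, ∀ z ∈ polyDisc q \ ncDivisor q l,
      |χ z| ≤ C * (Real.log |Real.log (maxCoordNorm q l z)|) ^ p + C) :
    ∃ χ' : (Fin q → ℂ) → ℝ, PluriharmOn q χ' (polyDisc q) ∧
      ∀ z ∈ polyDisc q \ ncDivisor q l, χ' z = χ z := by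
  obtain ⟨C, -, p, hg⟩ := hgrowth
  have hopen : IsOpen (polyDisc q \ ncDivisor q l) :=
    (isOpen_polyDisc q).sdiff (isClosed_ncDivisor q l)
  have hline : ∀ a b : Fin q → ℂ, HarmonicOnNhd (fun t : ℂ => χ (a + t • b))
      {t : ℂ | a + t • b ∈ polyDisc q \ ncDivisor q l} := fun a b =>
    (hharm a b).harmonicOnNhd (hopen.preimage (by fun_prop))
  have hcont : ContinuousOn χ (polyDisc q \ ncDivisor q l) := by
    refine PluriharmOn.continuousOn hharm hopen fun z hz => ?_
    have hpos : 0 < maxCoordNorm q l z :=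
      (norm_pos_iff.2 fun h0 => hz.2 ⟨⟨0, hl.trans hlq⟩, hl, h0⟩).trans_le
        (norm_le_maxCoordNorm z (i := ⟨0, hl.trans hlq⟩) hl)
    obtain ⟨M, hM⟩ := exists_eventually_abs_le_of_growth (hl.trans hlq) hg hz.1 hpos
    refine ⟨M, ?_⟩
    filter_upwards [hM, hopen.mem_nhds hz] with w h1 h2 using h1 h2
  -- the extension along the diagonal through `z`
  set E : (Fin q → ℂ) → ℂ → ℝ := fun z t => limUnder (𝓝[≠] t) fun s : ℂ => χ (z + s • 1) with hE
  have hEharm : ∀ z, HarmonicOnNhd (E z) {t : ℂ | z + t • 1 ∈ polyDisc q} := fun z =>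
    HarmonicOnNhd.limUnder_extension
      (fun t ht => (eventually_add_smul_mem_sdiff ht).mono fun s hs => hline z 1 s hs)
      (fun t ht => isLittleO_slice_log hl hlq hg ht)
  have hEeq : ∀ z t, z + t • 1 ∈ polyDisc q \ ncDivisor q l → E z t = χ (z + t • 1) := by
    intro z t ht
    refine Tendsto.limUnder_eq ?_
    exact (hline z 1 t ht).1.continuousAt.tendsto.mono_left nhdsWithin_le_nhds
  have hmem : ∀ (z : Fin q → ℂ) (r : ℝ), (∀ i, ‖z i‖ + r < 1) → ∀ s ∈ closedBall (0 : ℂ) r,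
      z + s • 1 ∈ polyDisc q := by
    intro z r hz s hs i
    have h1 : ‖s‖ ≤ r := by simpa using hs
    have h2 := norm_add_le (z i) s
    have h3 := hz i
    simp only [Pi.add_apply, Pi.smul_apply, Pi.one_apply, smul_eq_mul, mul_one]
    linarith
  have hmem' : ∀ (z : Fin q → ℂ) (r : ℝ), (∀ i, ‖z i‖ + r < 1) → (∀ i, ‖z i‖ ≠ r) →
      ∀ s ∈ sphere (0 : ℂ) r, z + s • 1 ∈ polyDisc q \ ncDivisor q l := by
    intro z r hz hne s hs
    refine ⟨hmem z r hz s (sphere_subset_closedBall hs), fun ⟨i, _, hi⟩ => hne i ?_⟩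
    simp only [Pi.add_apply, Pi.smul_apply, Pi.one_apply, smul_eq_mul, mul_one] at hi
    rw [eq_neg_of_add_eq_zero_left hi, norm_neg]
    simpa using hs
  have hmean : ∀ (z : Fin q → ℂ) (r : ℝ), 0 < r → (∀ i, ‖z i‖ + r < 1) → (∀ i, ‖z i‖ ≠ r) →
      E z 0 = Real.circleAverage (fun s : ℂ => χ (z + s • 1)) 0 r := by
    intro z r hr hz hne
    rw [← InnerProductSpace.HarmonicOnNhd.circleAverage_eq (f := E z) (c := 0) (R := r)]
    · refine Real.circleAverage_congr_sphere fun s hs => ?_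
      rw [abs_of_pos hr] at hs
      exact hEeq z s (hmem' z r hz hne s hs)
    · rw [abs_of_pos hr]
      exact (hEharm z).mono (hmem z r hz)
  refine ⟨fun z => E z 0, fun a b => HarmonicOnNhd.harmOn fun t₀ ht₀ => ?_, fun z hz => ?_⟩
  swap
  · simpa using hEeq z 0 (by simpa using hz)
  set z₀ := a + t₀ • b with hz₀
  have hz₀U : z₀ ∈ polyDisc q := ht₀
  obtain ⟨r, hr, hr1, hr2⟩ : ∃ r > 0, (∀ i, ‖z₀ i‖ + r < 1) ∧ ∀ i, ‖z₀ i‖ ≠ r := by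
    have h1 : ∀ᶠ r : ℝ in 𝓝[>] 0, ∀ i, ‖z₀ i‖ + r < 1 := by
      refine eventually_all.2 fun i => Eventually.filter_mono nhdsWithin_le_nhds ?_
      filter_upwards [eventually_lt_nhds (show (0 : ℝ) < 1 - ‖z₀ i‖ by linarith [hz₀U i])]
        with r hr
      linarith
    have h2 : ∀ᶠ r : ℝ in 𝓝[>] 0, ∀ i, ‖z₀ i‖ ≠ r :=
      eventually_all.2 fun i => ((eventually_nhdsNE_ne 0 _).filter_mono
        (nhdsWithin_mono _ fun x (hx : 0 < x) => hx.ne')).mono fun r hr => hr.symm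
    obtain ⟨r, hr, hr1, hr2⟩ := (eventually_mem_nhdsWithin.and (h1.and h2)).exists
    exact ⟨r, hr, hr1, hr2⟩
  obtain ⟨ρ, hρ, hρ'⟩ : ∃ ρ > 0, ∀ t ∈ closedBall (0 : ℂ) ρ,
      (∀ i, ‖(z₀ + t • b) i‖ + r < 1) ∧ ∀ i, ‖(z₀ + t • b) i‖ ≠ r := by
    have hn : ∀ i, ContinuousAt (fun t : ℂ => ‖(z₀ + t • b) i‖) 0 := fun i => by fun_prop
    have h1 : ∀ᶠ t : ℂ in 𝓝 0, ∀ i, ‖(z₀ + t • b) i‖ + r < 1 :=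
      eventually_all.2 fun i => ((hn i).add_const r).eventually_lt continuousAt_const
        (by simpa using hr1 i)
    have h2 : ∀ᶠ t : ℂ in 𝓝 0, ∀ i, ‖(z₀ + t • b) i‖ ≠ r :=
      eventually_all.2 fun i => (hn i).eventually_ne (by simpa using hr2 i)
    exact Metric.nhds_basis_closedBall.eventually_iff.1 (h1.and h2)
  have hG : ∀ s ∈ sphere (0 : ℂ) r, ∀ t ∈ closedBall (0 : ℂ) ρ,
      z₀ + t • b + s • 1 ∈ polyDisc q \ ncDivisor q l := fun s hs t ht =>
    hmem' _ r (hρ' t ht).1 (hρ' t ht).2 s hs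
  obtain ⟨F, hF, hFeq⟩ := exists_analyticAt_re_eq_circleAverage
    (G := fun s t => χ (z₀ + t • b + s • 1)) hr hρ
    (hcont.comp (f := fun x : ℂ × ℂ => z₀ + x.2 • b + x.1 • 1) (by fun_prop)
      fun x hx => hG x.1 hx.1 x.2 hx.2)
    (fun s hs t ht => by
      have := hline (z₀ + s • 1) b t (by
        rw [mem_ofPred_eq, add_right_comm]
        exact hG s hs t ht)
      simpa only [add_right_comm] using this)
  have hFs : AnalyticAt ℂ (fun t => F (t - t₀)) t₀ :=
    AnalyticAt.fun_comp (by simpa using hF) (by fun_prop)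
  refine (harmonicAt_congr_nhds ?_).1 hFs.harmonicAt_re
  filter_upwards [ball_mem_nhds t₀ hρ] with t ht
  have ht' : t - t₀ ∈ ball (0 : ℂ) ρ := by simpa [dist_eq_norm] using ht
  have hz : a + t • b = z₀ + (t - t₀) • b := by
    rw [hz₀, sub_smul]
    abel
  have hρt := hρ' _ (ball_subset_closedBall ht')
  rw [hz, hmean _ r hr hρt.1 hρt.2]
  exact (hFeq _ ht').symm
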